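/- There exists δ_E in (0,1) (one may take δ_E = 1 − 1/C_E, with C_E the constant of the curve lemma for E) such that for every δ in (δ_E, 1) there exist a Lipschitz function u : ℝ² → ℝ and a Borel set S ⊆ E ∩ (0,1)² of positive Lebesgue measure such that u is differentiable at every x in S and (1 − δ) ‖Du(x)‖² < ( apLip_{d_δ} u(x) )² for all x in S. Since dΓ_δ(u,u)/dm = (1 − δ·1_E)‖Du‖² a.e. for Lipschitz u, this says that the intrinsic length structure and the gradient structure of the perturbed Dirichlet form E_δ do not coincide. -/

import Mathlib

open MeasureTheory Metric Filter Topology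
open scoped NNReal ENNReal

noncomputable section

/-- The plane with the Euclidean distance. -/
abbrev E2 := EuclideanSpace ℝ (Fin 2)

/-- Length of the level-`n` intervals of the Cantor construction: at each step the open
middle interval of length `(1/10)^(n+1)` is removed and two closed intervals of equal
length remain. -/
def clen : ℕ → ℝ
  | 0 => 1
  | n + 1 => (clen n - (1 / 10) ^ (n + 1)) / 2

/-- Left endpoint of the interval `I_w`; words are written with the innermost (deepest)
digit first, `false` = left child, `true` = right child. -/
def cleft : List Bool → ℝ
  | [] => 0
  | b :: w => cleft w + if b then clen w.length - clen (w.length + 1) else 0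

/-- The interval `I_w` of the Cantor construction. -/
def cInt (w : List Bool) : Set ℝ := Set.Icc (cleft w) (cleft w + clen w.length)

/-- The fat Cantor set `F`. -/
def cantorF : Set ℝ := ⋂ n : ℕ, ⋃ w ∈ {w : List Bool | w.length = n}, cInt w

/-- The planar Cantor set `E = F × F`. -/
def cantorE : Set E2 := {z | z 0 ∈ cantorF ∧ z 1 ∈ cantorF}

/-- The intrinsic distance `d_δ` of the perturbed Dirichlet form
`E_δ(u,u) = ∫ (1 − δ 1_E) |∇u|² dm`. -/
def dDelta (δ : ℝ) (x y : E2) : ℝ :=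
  sSup {r : ℝ | ∃ u : E2 → ℝ, (∃ L : ℝ≥0, LipschitzWith L u) ∧
    (∀ᵐ z ∂volume, (z ∉ cantorE → ‖fderiv ℝ u z‖ ≤ 1) ∧
      (z ∈ cantorE → ‖fderiv ℝ u z‖ ≤ 1 / Real.sqrt (1 - δ))) ∧
    r = u x - u y}

/-- `A` has Lebesgue density `1` at `x`. -/
def DensityOneAt (A : Set E2) (x : E2) : Prop :=
  Tendsto (fun r : ℝ => volume (A ∩ ball x r) / volume (ball x r)) (𝓝[>] 0) (𝓝 1)

/-- The approximate pointwise Lipschitz constant of `u` at `x` with respect to the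
distance `ρ`. -/
noncomputable def apLipD (ρ : E2 → E2 → ℝ) (u : E2 → ℝ) (x : E2) : ℝ :=
  sInf {L : ℝ | ∃ A : Set E2, MeasurableSet A ∧ DensityOneAt A x ∧
    L = limsup (fun y => |u x - u y| / ρ x y) (𝓝[A \ {x}] x)}

/-- The open unit square `(0,1)²`. -/
def openUnitSq : Set E2 := {z | z 0 ∈ Set.Ioo (0 : ℝ) 1 ∧ z 1 ∈ Set.Ioo (0 : ℝ) 1}

/-! ### The Cantor set `F` -/

lemma clen_succ (n : ℕ) : 2 * clen (n + 1) + (1 / 10) ^ (n + 1) = clen n := by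
  rw [clen]; ring

lemma pow_le_clen (n : ℕ) : (1 / 10 : ℝ) ^ n ≤ clen n := by
  induction n with
  | zero => simp [clen]
  | succ n ih =>
    have h := clen_succ n
    have hp : (0 : ℝ) < (1 / 10) ^ n := by positivity
    rw [pow_succ] at h ⊢
    linarith

lemma clen_pos (n : ℕ) : 0 < clen n :=
  lt_of_lt_of_le (by positivity) (pow_le_clen n)

lemma clen_le (n : ℕ) : clen n ≤ (1 / 2) ^ n := by
  induction n with
  | zero => simp [clen]
  | succ n ih =>
    have h := clen_succ n
    have hp : (0 : ℝ) < (1 / 10) ^ (n + 1) := by positivity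
    rw [pow_succ (1 / 2 : ℝ)]
    linarith

lemma two_pow_mul_clen (n : ℕ) : 2 ^ n * clen n = 7 / 8 + 1 / 8 * (1 / 5) ^ n := by
  induction n with
  | zero => norm_num [clen]
  | succ n ih =>
    have h := clen_succ n
    have h5 : (2 : ℝ) ^ n * (1 / 10) ^ n = (1 / 5) ^ n := by
      rw [← mul_pow]; norm_num
    rw [pow_succ (1 / 10 : ℝ)] at h
    calc (2 : ℝ) ^ (n + 1) * clen (n + 1) = 2 ^ n * (2 * clen (n + 1)) := by ring
      _ = 2 ^ n * clen n - 2 ^ n * (1 / 10) ^ n * (1 / 10) := by rw [← h]; ring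
      _ = _ := by rw [ih, h5]; ring

/-- The union of the level-`n` intervals. -/
def cLevel (n : ℕ) : Set ℝ := ⋃ w ∈ {w : List Bool | w.length = n}, cInt w

lemma mem_cLevel {n : ℕ} {x : ℝ} : x ∈ cLevel n ↔ ∃ w : List Bool, w.length = n ∧ x ∈ cInt w := by
  simp [cLevel]

lemma cantorF_eq_iInter_cLevel : cantorF = ⋂ n, cLevel n := rfl

lemma mem_cInt_false {w : List Bool} {x : ℝ} :
    x ∈ cInt (false :: w) ↔ cleft w ≤ x ∧ x ≤ cleft w + clen (w.length + 1) := by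
  simp [cInt, cleft]

lemma mem_cInt_true {w : List Bool} {x : ℝ} :
    x ∈ cInt (true :: w) ↔
      cleft w + clen w.length - clen (w.length + 1) ≤ x ∧ x ≤ cleft w + clen w.length := by
  simp only [cInt, cleft, Set.mem_Icc, List.length_cons, if_true]
  constructor <;> rintro ⟨h1, h2⟩ <;> constructor <;> linarith

lemma cInt_cons_subset (b : Bool) (w : List Bool) : cInt (b :: w) ⊆ cInt w := by
  intro x hx
  have h := clen_succ w.length
  have h1 := clen_pos (w.length + 1)
  have hp : (0 : ℝ) < (1 / 10) ^ (w.length + 1) := by positivity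
  cases b
  · rw [mem_cInt_false] at hx
    exact ⟨hx.1, by linarith⟩
  · rw [mem_cInt_true] at hx
    exact ⟨by linarith, hx.2⟩

lemma eq_of_mem_cInt {x : ℝ} : ∀ {w w' : List Bool}, w.length = w'.length →
    x ∈ cInt w → x ∈ cInt w' → w = w'
  | [], [], _, _, _ => rfl
  | b :: w, b' :: w', hl, hx, hx' => by
    obtain rfl : w = w' := eq_of_mem_cInt (by simpa using hl)
      (cInt_cons_subset _ _ hx) (cInt_cons_subset _ _ hx')
    have h := clen_succ w.length
    have hp : (0 : ℝ) < (1 / 10) ^ (w.length + 1) := by positivity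
    cases b <;> cases b' <;> simp only [mem_cInt_false, mem_cInt_true] at hx hx' <;>
      first | rfl | (exfalso; linarith)

lemma cLevel_antitone : Antitone cLevel := by
  refine antitone_nat_of_succ_le fun n x hx => ?_
  obtain ⟨w, hw, hx⟩ := mem_cLevel.1 hx
  match w, hw with
  | b :: w, hw => exact mem_cLevel.2 ⟨w, by simpa using hw, cInt_cons_subset _ _ hx⟩

lemma isClosed_cLevel (n : ℕ) : IsClosed (cLevel n) :=
  (List.finite_length_eq Bool n).isClosed_biUnion fun _ _ => isClosed_Icc

lemma isClosed_cantorF : IsClosed cantorF :=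
  isClosed_iInter isClosed_cLevel

/-- The midpoint of `I_w` lies in the gap removed from `I_w`. -/
lemma midpoint_notMem_cantorF (w : List Bool) : cleft w + clen w.length / 2 ∉ cantorF := by
  intro hx
  have hpos := clen_pos w.length
  obtain ⟨w', hw', hx'⟩ := mem_cLevel.1 (Set.mem_iInter.1 hx (w.length + 1))
  match w', hw' with
  | b :: w', hw' =>
    obtain rfl : w = w' := eq_of_mem_cInt (by simpa using hw'.symm)
      ⟨by linarith, by linarith⟩ (cInt_cons_subset _ _ hx')
    have h := clen_succ w.length
    have hp : (0 : ℝ) < (1 / 10) ^ (w.length + 1) := by positivity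
    cases b <;> simp only [mem_cInt_false, mem_cInt_true] at hx' <;> linarith

lemma dense_compl_cantorF : Dense cantorFᶜ := by
  intro x
  by_cases hx : x ∈ cantorF
  swap
  · exact subset_closure hx
  refine Metric.mem_closure_iff.2 fun ε hε => ?_
  obtain ⟨n, hn⟩ := exists_pow_lt_of_lt_one hε (by norm_num : (1 / 2 : ℝ) < 1)
  obtain ⟨w, rfl, hxw⟩ := mem_cLevel.1 (Set.mem_iInter.1 hx n)
  refine ⟨_, midpoint_notMem_cantorF w, ?_⟩
  have h1 := clen_le w.length
  have h2 := clen_pos w.length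
  have h3 := hxw.1
  have h4 := hxw.2
  rw [Real.dist_eq, abs_lt]
  constructor <;> linarith

lemma volume_cInt_diff_cLevel_le (k : ℕ) : ∀ w : List Bool,
    volume (cInt w \ cLevel (w.length + k)) ≤
      ENNReal.ofReal (clen w.length - 2 ^ k * clen (w.length + k)) := by
  induction k with
  | zero =>
    intro w
    have : cInt w \ cLevel (w.length + 0) = ∅ :=
      Set.sdiff_eq_empty.2 fun x hx => mem_cLevel.2 ⟨w, rfl, hx⟩
    rw [this, measure_empty]
    exact zero_le
  | succ k ih =>
    intro w
    have hlen := clen_succ w.length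
    have hidx : w.length + 1 + k = w.length + (k + 1) := by ring
    have hf := ih (false :: w)
    have ht := ih (true :: w)
    simp only [List.length_cons, hidx] at hf ht
    have hnn : 0 ≤ clen (w.length + 1) - 2 ^ k * clen (w.length + (k + 1)) := by
      have e1 := two_pow_mul_clen (w.length + 1)
      have e2 := two_pow_mul_clen (w.length + (k + 1))
      have e3 : (1 / 5 : ℝ) ^ (w.length + (k + 1)) ≤ (1 / 5) ^ (w.length + 1) :=
        pow_le_pow_of_le_one (by norm_num) (by norm_num) (by omega)
      have e4 : (2 : ℝ) ^ (w.length + (k + 1)) = 2 ^ (w.length + 1) * 2 ^ k := by ring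
      rw [e4] at e2
      have e5 : (0 : ℝ) < 2 ^ (w.length + 1) := by positivity
      refine nonneg_of_mul_nonneg_right (a := (2 : ℝ) ^ (w.length + 1)) ?_ e5
      linarith
    have hsub : cInt w \ cLevel (w.length + (k + 1)) ⊆
        Set.Ioo (cleft w + clen (w.length + 1)) (cleft w + clen w.length - clen (w.length + 1)) ∪
          (cInt (false :: w) \ cLevel (w.length + (k + 1)) ∪
            cInt (true :: w) \ cLevel (w.length + (k + 1))) := by
      rintro x ⟨hx, hxL⟩
      by_cases h1 : x ∈ cInt (false :: w)
      · exact Or.inr (Or.inl ⟨h1, hxL⟩)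
      by_cases h2 : x ∈ cInt (true :: w)
      · exact Or.inr (Or.inr ⟨h2, hxL⟩)
      rw [mem_cInt_false] at h1
      rw [mem_cInt_true] at h2
      push Not at h1 h2
      refine Or.inl ⟨h1 hx.1, ?_⟩
      by_contra! h3
      exact absurd hx.2 (not_le.2 (h2 h3))
    have hp : (0 : ℝ) < (1 / 10) ^ (w.length + 1) := by positivity
    calc volume (cInt w \ cLevel (w.length + (k + 1)))
        ≤ volume (Set.Ioo (cleft w + clen (w.length + 1))
            (cleft w + clen w.length - clen (w.length + 1))) +
          (volume (cInt (false :: w) \ cLevel (w.length + (k + 1))) +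
            volume (cInt (true :: w) \ cLevel (w.length + (k + 1)))) :=
          (measure_mono hsub).trans ((measure_union_le _ _).trans
            (add_le_add le_rfl (measure_union_le _ _)))
      _ ≤ ENNReal.ofReal ((1 / 10) ^ (w.length + 1)) +
          (ENNReal.ofReal (clen (w.length + 1) - 2 ^ k * clen (w.length + (k + 1))) +
            ENNReal.ofReal (clen (w.length + 1) - 2 ^ k * clen (w.length + (k + 1)))) := by
          refine add_le_add ?_ (add_le_add hf ht)
          rw [Real.volume_Ioo]
          exact ENNReal.ofReal_le_ofReal (by linarith)
      _ = ENNReal.ofReal (clen w.length - 2 ^ (k + 1) * clen (w.length + (k + 1))) := by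
          rw [← ENNReal.ofReal_add hnn hnn, ← ENNReal.ofReal_add hp.le (by linarith)]
          congr 1
          rw [← hlen]
          ring

lemma volume_Icc_diff_cantorF_le :
    volume (Set.Icc (0 : ℝ) 1 \ cantorF) ≤ ENNReal.ofReal (1 / 8) := by
  have hU : Set.Icc (0 : ℝ) 1 \ cantorF = ⋃ n, Set.Icc (0 : ℝ) 1 \ cLevel n := by
    rw [cantorF_eq_iInter_cLevel, Set.sdiff_iInter]
  have hmono : Monotone fun n => Set.Icc (0 : ℝ) 1 \ cLevel n := fun m n hmn =>
    Set.sdiff_subset_sdiff_right (cLevel_antitone hmn)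
  rw [hU, hmono.measure_iUnion]
  refine iSup_le fun n => ?_
  have h := volume_cInt_diff_cLevel_le n []
  simp only [List.length_nil, zero_add, two_pow_mul_clen, cInt, cleft, clen] at h
  refine h.trans (ENNReal.ofReal_le_ofReal ?_)
  have : (0 : ℝ) < (1 / 5) ^ n := by positivity
  linarith

lemma volume_cantorF_inter_Ioo_pos : 0 < volume (cantorF ∩ Set.Ioo 0 1) := by
  rw [pos_iff_ne_zero]
  intro h0
  have hsub : Set.Ioo (0 : ℝ) 1 ⊆ (cantorF ∩ Set.Ioo 0 1) ∪ (Set.Icc (0 : ℝ) 1 \ cantorF) := by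
    intro x hx
    by_cases hF : x ∈ cantorF
    · exact Or.inl ⟨hF, hx⟩
    · exact Or.inr ⟨Set.Ioo_subset_Icc_self hx, hF⟩
  have h := (measure_mono (μ := volume) hsub).trans (measure_union_le _ _)
  rw [h0, zero_add, Real.volume_Ioo] at h
  have h' := h.trans volume_Icc_diff_cantorF_le
  rw [ENNReal.ofReal_le_ofReal_iff (by norm_num)] at h'
  norm_num at h'

/-! ### Coordinates on the plane -/

lemma measurePreserving_vec :
    MeasurePreserving (fun p : ℝ × ℝ => (!₂[p.1, p.2] : E2)) volume volume :=
  (PiLp.volume_preserving_toLp (Fin 2)).comp (volume_preserving_finTwoArrow ℝ).symm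

lemma measurePreserving_vec_swap :
    MeasurePreserving (fun p : ℝ × ℝ => (!₂[p.2, p.1] : E2)) volume volume :=
  measurePreserving_vec.comp Measure.measurePreserving_swap

lemma measurableSet_cantorE : MeasurableSet cantorE := by
  have h (i : Fin 2) : Continuous fun z : E2 => z i := by fun_prop
  exact ((isClosed_cantorF.preimage (h 0)).inter (isClosed_cantorF.preimage (h 1))).measurableSet

lemma measurableSet_openUnitSq : MeasurableSet openUnitSq := by
  have h (i : Fin 2) : Continuous fun z : E2 => z i := by fun_prop
  exact ((isOpen_Ioo.preimage (h 0)).inter (isOpen_Ioo.preimage (h 1))).measurableSet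

lemma volume_cantorE_inter_openUnitSq_pos : 0 < volume (cantorE ∩ openUnitSq) := by
  rw [← measurePreserving_vec.measure_preimage
    (measurableSet_cantorE.inter measurableSet_openUnitSq).nullMeasurableSet]
  have : (fun p : ℝ × ℝ => (!₂[p.1, p.2] : E2)) ⁻¹' (cantorE ∩ openUnitSq) =
      (cantorF ∩ Set.Ioo 0 1) ×ˢ (cantorF ∩ Set.Ioo 0 1) := by
    ext p
    simp [cantorE, openUnitSq]
    tauto
  rw [this, Measure.volume_eq_prod, Measure.prod_prod]
  exact ENNReal.mul_pos volume_cantorF_inter_Ioo_pos.ne' volume_cantorF_inter_Ioo_pos.ne'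

/-! ### The intrinsic distance is comparable to the Euclidean one -/

/-- A Lipschitz function whose derivative is bounded by `1` almost everywhere along a line with
direction of norm at most `1` is `1`-Lipschitz along that line. -/
lemma LipschitzWith.abs_sub_le_of_ae_line {V : Type*} [NormedAddCommGroup V] [NormedSpace ℝ V]
    {v : V → ℝ} {L : ℝ≥0} (hv : LipschitzWith L v) {γ : ℝ → V} {e : V}
    (he : ‖e‖ ≤ 1) (hγ : ∀ t, HasDerivAt γ e t)
    (h : ∀ᵐ t : ℝ, DifferentiableAt ℝ v (γ t) ∧ ‖fderiv ℝ v (γ t)‖ ≤ 1) (s t : ℝ) :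
    |v (γ t) - v (γ s)| ≤ |t - s| := by
  have hγL : LipschitzWith 1 γ :=
    lipschitzWith_of_nnnorm_deriv_le (fun t => (hγ t).differentiableAt) fun t => by
      rw [(hγ t).deriv]; exact_mod_cast he
  have hac := ((hv.comp hγL).lipschitzOnWith (s := Set.uIcc s t)).absolutelyContinuousOnInterval
  have h1 := hac.integral_deriv_eq_sub
  have h2 : ‖∫ x in s..t, deriv (v ∘ γ) x‖ ≤ 1 * |t - s| := by
    refine intervalIntegral.norm_integral_le_of_norm_le_const_ae ?_
    filter_upwards [h] with x hx _
    rw [(hx.1.hasFDerivAt.comp_hasDerivAt x (hγ x)).deriv]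
    calc ‖fderiv ℝ v (γ x) e‖ ≤ ‖fderiv ℝ v (γ x)‖ * ‖e‖ := ContinuousLinearMap.le_opNorm _ _
      _ ≤ 1 := mul_le_one₀ hx.2 (norm_nonneg _) he
  rw [h1, one_mul] at h2
  exact h2

lemma LipschitzWith.abs_sub_le_of_lines {v : E2 → ℝ} {L : ℝ≥0} (hv : LipschitzWith L v)
    (hE : ∀ᵐ z ∂volume, z ∉ cantorE → ‖fderiv ℝ v z‖ ≤ 1) {ψ : ℝ × ℝ → E2} {e : E2}
    (hψ : MeasurePreserving ψ volume volume) (hψc : Continuous ψ) (he : ‖e‖ ≤ 1)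
    (hγ : ∀ s t, HasDerivAt (fun t => ψ (s, t)) e t)
    (hF : ∀ s t, s ∉ cantorF → ψ (s, t) ∉ cantorE) (s t t' : ℝ) :
    |v (ψ (s, t)) - v (ψ (s, t'))| ≤ |t - t'| := by
  have hae : ∀ᵐ s : ℝ, ∀ᵐ t : ℝ, DifferentiableAt ℝ v (ψ (s, t)) ∧
      (ψ (s, t) ∉ cantorE → ‖fderiv ℝ v (ψ (s, t))‖ ≤ 1) :=
    Measure.ae_ae_of_ae_prod
      (hψ.quasiMeasurePreserving.ae (hv.ae_differentiableAt.and hE))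
  have hdense : Dense ({s : ℝ | ∀ᵐ t : ℝ, DifferentiableAt ℝ v (ψ (s, t)) ∧
      (ψ (s, t) ∉ cantorE → ‖fderiv ℝ v (ψ (s, t))‖ ≤ 1)} ∩ cantorFᶜ) :=
    (Measure.dense_of_ae hae).inter_of_isOpen_right dense_compl_cantorF
      isClosed_cantorF.isOpen_compl
  have hclosed : IsClosed {s : ℝ | |v (ψ (s, t)) - v (ψ (s, t'))| ≤ |t - t'|} := by
    have := hv.continuous
    exact isClosed_le (by fun_prop) (by fun_prop)
  refine closure_minimal ?_ hclosed (hdense s)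
  rintro s ⟨hs, hsF⟩
  rw [Set.mem_ofPred_eq] at hs ⊢
  exact hv.abs_sub_le_of_ae_line he (hγ s)
    (hs.mono fun t ht => ⟨ht.1, ht.2 (hF s t hsF)⟩) t' t

lemma hasDerivAt_euclidean {γ : ℝ → E2} {e : E2} {t : ℝ}
    (h : ∀ i, HasDerivAt (fun t => γ t i) (e i) t) : HasDerivAt γ e t := by
  rw [hasDerivAt_iff_hasFDerivAt, ← hasFDerivWithinAt_univ, hasFDerivWithinAt_euclidean]
  intro i
  convert! (h i).hasFDerivAt.hasFDerivWithinAt (s := Set.univ) using 1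

lemma LipschitzWith.sub_le_of_ae_norm_fderiv_le {v : E2 → ℝ} {L : ℝ≥0} (hv : LipschitzWith L v)
    (hE : ∀ᵐ z ∂volume, z ∉ cantorE → ‖fderiv ℝ v z‖ ≤ 1) (x y : E2) :
    v x - v y ≤ |x 0 - y 0| + |x 1 - y 1| := by
  have hvert := hv.abs_sub_le_of_lines hE measurePreserving_vec (by fun_prop)
    (e := EuclideanSpace.single 1 1) (by simp)
    (fun s t => by
      refine hasDerivAt_euclidean fun i => ?_
      fin_cases i
      · simpa using hasDerivAt_const t s
      · simpa using hasDerivAt_id' t)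
    (fun s t hs h => hs (by simpa using h.1)) (x 0) (x 1) (y 1)
  have hhor := hv.abs_sub_le_of_lines hE measurePreserving_vec_swap (by fun_prop)
    (e := EuclideanSpace.single 0 1) (by simp)
    (fun s t => by
      refine hasDerivAt_euclidean fun i => ?_
      fin_cases i
      · simpa using hasDerivAt_id' t
      · simpa using hasDerivAt_const t s)
    (fun s t hs h => hs (by simpa using h.2)) (y 1) (x 0) (y 0)
  have hx : (!₂[x 0, x 1] : E2) = x := by ext i; fin_cases i <;> rfl
  have hy : (!₂[y 0, y 1] : E2) = y := by ext i; fin_cases i <;> rfl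
  simp only [hx, hy] at hvert hhor
  linarith [le_of_abs_le hvert, le_of_abs_le hhor]

lemma dDelta_le (δ : ℝ) (x y : E2) : dDelta δ x y ≤ |x 0 - y 0| + |x 1 - y 1| := by
  refine Real.sSup_le ?_ (by positivity)
  rintro r ⟨v, ⟨L, hv⟩, hE, rfl⟩
  exact hv.sub_le_of_ae_norm_fderiv_le (hE.mono fun z hz => hz.1) x y

lemma norm_proj_zero_le : ‖(EuclideanSpace.proj 0 : E2 →L[ℝ] ℝ)‖ ≤ 1 :=
  ContinuousLinearMap.opNorm_le_bound _ zero_le_one fun x => by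
    simpa using PiLp.norm_apply_le x 0

lemma abs_sub_le_dDelta {δ : ℝ} (hδ : δ ∈ Set.Ioo (0 : ℝ) 1) (x y : E2) :
    |x 0 - y 0| ≤ dDelta δ x y := by
  have hbdd : BddAbove {r : ℝ | ∃ u : E2 → ℝ, (∃ L : ℝ≥0, LipschitzWith L u) ∧
      (∀ᵐ z ∂volume, (z ∉ cantorE → ‖fderiv ℝ u z‖ ≤ 1) ∧
        (z ∈ cantorE → ‖fderiv ℝ u z‖ ≤ 1 / Real.sqrt (1 - δ))) ∧ r = u x - u y} := by
    refine ⟨|x 0 - y 0| + |x 1 - y 1|, ?_⟩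
    rintro r ⟨v, ⟨L, hv⟩, hE, rfl⟩
    exact hv.sub_le_of_ae_norm_fderiv_le (hE.mono fun z hz => hz.1) x y
  have h1 : 1 ≤ 1 / Real.sqrt (1 - δ) := by
    rw [le_div_iff₀ (Real.sqrt_pos.2 (by linarith [hδ.2])), one_mul]
    exact Real.sqrt_le_one.2 (by linarith [hδ.1])
  have key (T : E2 →L[ℝ] ℝ) (hT : ‖T‖ ≤ 1) : T x - T y ≤ dDelta δ x y :=
    le_csSup hbdd ⟨T, ⟨_, T.lipschitz⟩, .of_forall fun z => by
      rw [T.fderiv]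
      exact ⟨fun _ => hT, fun _ => hT.trans h1⟩, rfl⟩
  have hp := key (EuclideanSpace.proj 0) norm_proj_zero_le
  have hn := key (-EuclideanSpace.proj 0) (by rw [norm_neg]; exact norm_proj_zero_le)
  have hn' : -x 0 - -y 0 ≤ dDelta δ x y := hn
  exact abs_le.2 ⟨by linarith, hp⟩

/-! ### Density points and the approximate Lipschitz constant -/

/-- A set of density one at `x` contains points arbitrarily close to `x` in the double cone
around the first axis. -/
lemma DensityOneAt.frequently_mem_cone {A : Set E2} {x : E2} (hA : DensityOneAt A x) :
    ∃ᶠ y in 𝓝[A \ {x}] x, 0 < |x 0 - y 0| ∧ |x 1 - y 1| ≤ |x 0 - y 0| := by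
  rw [Filter.frequently_iff]
  intro U hU
  obtain ⟨ε, hε, hεU⟩ := Metric.mem_nhdsWithin_iff.1 hU
  have hev : ∀ᶠ r : ℝ in 𝓝[>] 0,
      1 - ENNReal.ofReal ((1 / 8) ^ 2) < volume (A ∩ ball x r) / volume (ball x r) := by
    refine hA.eventually (lt_mem_nhds (ENNReal.sub_lt_self (by simp) (by simp) ?_))
    simp
  obtain ⟨r, hr, hrε, hr0 : 0 < r⟩ :=
    (hev.and (((eventually_lt_nhds hε).filter_mono nhdsWithin_le_nhds).and
      self_mem_nhdsWithin)).exists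
  set c : E2 := x + EuclideanSpace.single 0 (r / 2) with hc
  have hdist : dist c x = r / 2 := by
    rw [hc, dist_eq_norm, add_sub_cancel_left, PiLp.norm_single, Real.norm_eq_abs,
      abs_of_pos (by positivity)]
  have hsub : ball c (r / 8) ⊆ ball x r := ball_subset_ball' (by rw [hdist]; linarith)
  have hball : volume (ball c (r / 8)) = ENNReal.ofReal ((1 / 8) ^ 2) * volume (ball x r) := by
    have h := Measure.addHaar_ball_mul_of_pos (volume : Measure E2) c
      (by norm_num : (0 : ℝ) < 1 / 8) r
    rw [finrank_euclideanSpace_fin] at h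
    rw [Measure.addHaar_ball_center volume x, ← h]
    congr 2
    ring
  have hne : (A ∩ ball c (r / 8)).Nonempty := by
    by_contra hempty
    rw [Set.not_nonempty_iff_eq_empty] at hempty
    have hle : volume (A ∩ ball x r) + volume (ball c (r / 8)) ≤ volume (ball x r) := by
      rw [← measure_union (Set.disjoint_left.2 fun z hz hz' =>
        (Set.eq_empty_iff_forall_notMem.1 hempty z) ⟨hz.1, hz'⟩) measurableSet_ball]
      exact measure_mono (Set.union_subset Set.inter_subset_right hsub)
    have hV0 : volume (ball x r) ≠ 0 := (measure_ball_pos _ _ hr0).ne'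
    have hVt : volume (ball x r) ≠ ∞ := measure_ball_lt_top.ne
    rw [ENNReal.lt_div_iff_mul_lt (Or.inl hV0) (Or.inl hVt), ENNReal.sub_mul (fun _ _ => hVt),
      one_mul, ← hball] at hr
    exact absurd hr (not_lt.2 (ENNReal.le_sub_of_add_le_right measure_ball_lt_top.ne hle))
  obtain ⟨y, hyA, hyc⟩ := hne
  have hcoord (i : Fin 2) : |y i - c i| < r / 8 := by
    have := PiLp.norm_apply_le (y - c) i
    rw [← dist_eq_norm] at this
    simpa using this.trans_lt hyc
  have h0 := abs_lt.1 (hcoord 0)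
  have h1 := abs_lt.1 (hcoord 1)
  simp only [hc, PiLp.add_apply, PiLp.single_apply] at h0 h1
  norm_num at h0 h1
  have habs : |x 0 - y 0| = y 0 - x 0 := by rw [abs_sub_comm, abs_of_pos (by linarith)]
  refine ⟨y, hεU ⟨ball_subset_ball hrε.le (hsub hyc), hyA, ?_⟩, ?_, ?_⟩
  · rintro rfl
    linarith
  · rw [habs]; linarith
  · rw [habs, abs_le]
    constructor <;> linarith

lemma densityOneAt_univ (x : E2) : DensityOneAt Set.univ x := by
  refine tendsto_const_nhds.congr' ?_
  filter_upwards [self_mem_nhdsWithin] with r hr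
  rw [Set.univ_inter, ENNReal.div_self (measure_ball_pos _ _ hr).ne' measure_ball_lt_top.ne]

lemma half_le_apLipD {δ : ℝ} (hδ : δ ∈ Set.Ioo (0 : ℝ) 1) (x : E2) :
    1 / 2 ≤ apLipD (dDelta δ) (fun z => z 0) x := by
  refine le_csInf ⟨_, Set.univ, .univ, densityOneAt_univ x, rfl⟩ ?_
  rintro _ ⟨A, -, hA, rfl⟩
  refine le_limsup_of_frequently_le ?_ (isBoundedUnder_of ⟨1, fun y => ?_⟩)
  · refine hA.frequently_mem_cone.mono fun y hy => ?_
    rw [le_div_iff₀ (hy.1.trans_le (abs_sub_le_dDelta hδ x y))]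
    linarith [dDelta_le δ x y, hy.2]
  · exact div_le_one_of_le₀ (abs_sub_le_dDelta hδ x y)
      ((abs_nonneg _).trans (abs_sub_le_dDelta hδ x y))

/-- there is `δ_E ∈ (0,1)` such that for every `δ ∈ (δ_E, 1)` there are a
Lipschitz `u : ℝ² → ℝ` and a Borel set `S ⊆ E ∩ (0,1)²` of positive measure on which `u`
is differentiable and `(1 − δ) ‖Du‖² < (apLip_{d_δ} u)²`. -/
theorem stmt7 :
    ∃ δ_E ∈ Set.Ioo (0 : ℝ) 1, ∀ δ ∈ Set.Ioo δ_E 1,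
      ∃ u : E2 → ℝ, (∃ L : ℝ≥0, LipschitzWith L u) ∧
        ∃ S : Set E2, MeasurableSet S ∧ S ⊆ cantorE ∩ openUnitSq ∧ 0 < volume S ∧
          ∀ x ∈ S, DifferentiableAt ℝ u x ∧
            (1 - δ) * ‖fderiv ℝ u x‖ ^ 2 < (apLipD (dDelta δ) u x) ^ 2 := by
  refine ⟨3 / 4, by norm_num, fun δ hδ => ?_⟩
  have hδ' : δ ∈ Set.Ioo (0 : ℝ) 1 := ⟨by linarith [hδ.1], hδ.2⟩
  set T : E2 →L[ℝ] ℝ := EuclideanSpace.proj 0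
  refine ⟨T, ⟨_, T.lipschitz⟩, cantorE ∩ openUnitSq,
    measurableSet_cantorE.inter measurableSet_openUnitSq, subset_rfl,
    volume_cantorE_inter_openUnitSq_pos, fun x _ => ⟨T.differentiableAt, ?_⟩⟩
  have hT : ‖T‖ ^ 2 ≤ 1 := pow_le_one₀ (norm_nonneg _) norm_proj_zero_le
  have hap : 1 / 2 ≤ apLipD (dDelta δ) T x := half_le_apLipD hδ' x
  rw [T.fderiv]
  calc (1 - δ) * ‖T‖ ^ 2 ≤ (1 - δ) * 1 := by gcongr; linarith [hδ.2]
    _ < (1 / 2) ^ 2 := by linarith [hδ.1]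
    _ ≤ apLipD (dDelta δ) T x ^ 2 := by gcongr

end
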